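/- Let (X,d) be a complete and connected metric space with 0 < ℋ¹(X) < ∞, equipped with the measure ℋ¹, and suppose there is a constant C₀ > 0 such that liminf_{r→0} ℋ¹(B(x,r))/r < C₀ for every x ∈ X. If u : X → ℝ satisfies Var(u,X) < ∞, then u is ℋ¹-measurable and there exists a sequence of curve-continuous functions u_i with u_i → u in L¹(X,ℋ¹) and limsup_{i→∞} pV(u_i,X) ≤ (3+4C₀)·Var(u,X). -/

import Mathlib

open MeasureTheory Set Filter Topology ENNReal

/-- A rectifiable curve parametrized by arc length: a map defined (in effect) on `[0, len]`
whose variation on every subinterval `[s,t] ⊆ [0,len]` equals `t - s`. -/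
structure MCurve (X : Type*) [MetricSpace X] where
  len : ℝ
  len_nonneg : 0 ≤ len
  toFun : ℝ → X
  arclength : ∀ s t : ℝ, s ∈ Set.Icc 0 len → t ∈ Set.Icc 0 len → s ≤ t →
    eVariationOn toFun (Set.Icc s t) = ENNReal.ofReal (t - s)

namespace MCurve

variable {X : Type*} [MetricSpace X]

/-- The image of a curve. -/
def image (γ : MCurve X) : Set X := γ.toFun '' Set.Icc 0 γ.len

/-- A curve is simple (injective) if its parametrization is injective on `[0, len]`. -/
def IsSimple (γ : MCurve X) : Prop := Set.InjOn γ.toFun (Set.Icc 0 γ.len)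

end MCurve

/-- Pointwise variation `pV(v, X)`: supremum over finite collections of pairwise disjoint
injective arc-length parametrized curves of the sums of endpoint differences. -/
noncomputable def pVar {X : Type*} [MetricSpace X] (v : X → ℝ) : ℝ≥0∞ :=
  ⨆ (n : ℕ) (γ : Fin n → MCurve X) (_ : ∀ i, (γ i).IsSimple)
    (_ : ∀ i j, i ≠ j → Disjoint (γ i).image (γ j).image),
    ∑ i, ENNReal.ofReal |v ((γ i).toFun (γ i).len) - v ((γ i).toFun 0)|

/-- Pointwise variation `pV_D(v, X)` with curve endpoints restricted to lie in `D`. -/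
noncomputable def pVarOn {X : Type*} [MetricSpace X] (D : Set X) (v : X → ℝ) : ℝ≥0∞ :=
  ⨆ (n : ℕ) (γ : Fin n → MCurve X) (_ : ∀ i, (γ i).IsSimple)
    (_ : ∀ i j, i ≠ j → Disjoint (γ i).image (γ j).image)
    (_ : ∀ i, (γ i).toFun 0 ∈ D ∧ (γ i).toFun (γ i).len ∈ D),
    ∑ i, ENNReal.ofReal |v ((γ i).toFun (γ i).len) - v ((γ i).toFun 0)|

/-- `Var(u, X)`: infimum of `pV(v, X)` over representatives `v = u` a.e. -/
noncomputable def VarH {X : Type*} [MetricSpace X] [MeasurableSpace X]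
    (μ : Measure X) (u : X → ℝ) : ℝ≥0∞ :=
  ⨅ (v : X → ℝ) (_ : v =ᵐ[μ] u), pVar v

/-- `g` is an upper gradient of `u`: `g` is Borel and the upper gradient inequality holds
along every arc-length parametrized rectifiable curve. -/
def IsUpperGradient {X : Type*} [MetricSpace X] [MeasurableSpace X]
    (u : X → ℝ) (g : X → ℝ≥0∞) : Prop :=
  Measurable g ∧ ∀ γ : MCurve X,
    ENNReal.ofReal |u (γ.toFun γ.len) - u (γ.toFun 0)| ≤ ∫⁻ s in Set.Icc 0 γ.len, g (γ.toFun s)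

/-- The total variation `‖Du‖(X)`: infimum of `liminf ∫ gᵢ dμ` over sequences `uᵢ → u` in
`L¹(X, μ)` with upper gradients `gᵢ`. -/
noncomputable def totalVarH {X : Type*} [MetricSpace X] [MeasurableSpace X]
    (μ : Measure X) (u : X → ℝ) : ℝ≥0∞ :=
  ⨅ (ui : ℕ → X → ℝ) (gi : ℕ → X → ℝ≥0∞) (_ : ∀ i, IsUpperGradient (ui i) (gi i))
    (_ : Filter.Tendsto (fun i => ∫⁻ x, ENNReal.ofReal |ui i x - u x| ∂μ)
      Filter.atTop (nhds 0)),
    Filter.atTop.liminf (fun i => ∫⁻ x, gi i x ∂μ)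

/-- A function is curve-continuous if it is continuous along every curve in `X`. -/
def CurveContinuous {X : Type*} [MetricSpace X] (v : X → ℝ) : Prop :=
  ∀ γ : MCurve X, ContinuousOn (v ∘ γ.toFun) (Set.Icc 0 γ.len)

section Geometry
variable {X : Type*} [MetricSpace X] [MeasurableSpace X] [BorelSpace X]

lemma conn_lower {C : Set X} (hC : IsPreconnected C) {f : X → ℝ} (hf : LipschitzWith 1 f)
    {p q : X} (hp : p ∈ C) (hq : q ∈ C) {a b : ℝ} (ha : f p ≤ a) (hb : b ≤ f q) :
    ENNReal.ofReal (b - a) ≤ μH[1] (C ∩ f ⁻¹' Ico a b) := by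
  have hsub : Ico a b ⊆ f '' (C ∩ f ⁻¹' Ico a b) := by
    intro t ht
    obtain ⟨z, hz, rfl⟩ := hC.intermediate_value hp hq hf.continuous.continuousOn
      (⟨ha.trans ht.1, ht.2.le.trans hb⟩ : t ∈ Icc (f p) (f q))
    exact ⟨z, ⟨hz, ht⟩, rfl⟩
  calc ENNReal.ofReal (b - a) = μH[1] (Ico a b) := by
        rw [hausdorffMeasure_real, Real.volume_Ico]
    _ ≤ μH[1] (f '' (C ∩ f ⁻¹' Ico a b)) := measure_mono hsub
    _ ≤ _ := by
        have := hf.hausdorffMeasure_image_le (d := 1) zero_le_one (C ∩ f ⁻¹' Ico a b)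
        simpa using this

lemma conn_ball {C : Set X} (hC : IsPreconnected C) {p q : X} (hp : p ∈ C) (hq : q ∈ C)
    {r : ℝ} (hr : r ≤ dist q p) : ENNReal.ofReal r ≤ μH[1] (C ∩ Metric.ball p r) := by
  have := conn_lower hC (LipschitzWith.dist_left p) hp hq (a := 0) (b := r) (by simp) hr
  rw [sub_zero] at this
  refine this.trans (measure_mono ?_)
  rintro z ⟨hz, hz2⟩
  exact ⟨hz, hz2.2⟩

lemma compact_of_fin [CompleteSpace X] [ConnectedSpace X] (h1 : μH[1] (Set.univ : Set X) < ⊤) :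
    CompactSpace X := by
  rw [← isCompact_univ_iff, isCompact_iff_totallyBounded_isComplete]
  refine ⟨?_, isComplete_univ⟩
  rw [Metric.totallyBounded_iff]
  intro ε hε
  by_cases hb : ∃ x : X, ∀ y, dist y x < ε
  · obtain ⟨x, hx⟩ := hb
    exact ⟨{x}, finite_singleton x, fun y _ => by simpa using hx y⟩
  push Not at hb
  -- maximal separated set
  obtain ⟨T, hT⟩ := zorn_subset {T : Set X | T.Pairwise fun x y => ε ≤ dist x y} (by
    intro c hc hch
    refine ⟨⋃₀ c, ?_, fun s hs => subset_sUnion_of_mem hs⟩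
    exact (pairwise_sUnion hch.directedOn).2 fun s hs => hc hs)
  have hsep : T.Pairwise fun x y => ε ≤ dist x y := hT.prop
  have hfin : T.Finite := by
    have h := Measure.finite_const_le_meas_of_disjoint_iUnion (μH[1] : Measure X)
      (ε := ENNReal.ofReal (ε/2)) (by simpa using hε) (As := fun t : T => Metric.ball (t:X) (ε/2))
      (fun _ => Metric.isOpen_ball.measurableSet) (by
        intro s t hst
        apply Metric.ball_disjoint_ball
        have := hsep s.2 t.2 (fun h => hst (Subtype.ext h))
        linarith) ((measure_mono (subset_univ _)).trans_lt h1).ne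
    have h2 : {i : T | ENNReal.ofReal (ε/2) ≤ μH[1] (Metric.ball (i:X) (ε/2))} = univ := by
      refine eq_univ_of_forall fun t => ?_
      obtain ⟨y, hy⟩ := hb t
      have := conn_ball (isPreconnected_univ) (mem_univ (t:X)) (mem_univ y) (r := ε/2) (by linarith)
      simpa using this
    rw [h2] at h
    have := Set.finite_univ_iff.1 h
    exact Set.toFinite _
  refine ⟨T, hfin, fun y _ => ?_⟩
  by_contra hy
  simp only [mem_iUnion, Metric.mem_ball, not_exists, not_lt] at hy
  have : insert y T ∈ {T : Set X | T.Pairwise fun x y => ε ≤ dist x y} := by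
    refine hsep.insert ?_
    intro b hb _
    exact ⟨hy b hb, by rw [dist_comm]; exact hy b hb⟩
  have hyT : y ∈ T := hT.le_of_ge this (subset_insert _ _) (mem_insert _ _)
  have := hy y hyT
  simp at this
  linarith

/-- boundary bumping -/
lemma bump [CompactSpace X] [ConnectedSpace X] {x w y : X} {ε : ℝ} (hw : ε ≤ dist w x)
    (hy : dist y x < ε) :
    ∃ z ∈ connectedComponentIn (Metric.closedBall x ε) y, ε ≤ dist z x := by
  by_contra hcon
  push Not at hcon
  set A := Metric.closedBall x ε with hA
  have hyA : y ∈ A := Metric.mem_closedBall.2 hy.le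
  have : CompactSpace A := isCompact_iff_compactSpace.1 Metric.isClosed_closedBall.isCompact
  rw [connectedComponentIn_eq_image hyA] at hcon
  have hsub : connectedComponent (⟨y, hyA⟩ : A) ⊆ {z : A | dist (z:X) x < ε} := by
    intro z hz
    exact hcon z ⟨z, hz, rfl⟩
  have hO : IsOpen {z : A | dist (z:X) x < ε} :=
    isOpen_lt (continuous_subtype_val.dist continuous_const) continuous_const
  rw [connectedComponent_eq_iInter_isClopen] at hsub
  have : Nonempty { s : Set A // IsClopen s ∧ (⟨y, hyA⟩ : A) ∈ s } := ⟨⟨univ, isClopen_univ, mem_univ _⟩⟩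
  obtain ⟨Z, hZ⟩ := exists_subset_nhds_of_isCompact' (V := fun s : { s : Set A // IsClopen s ∧ (⟨y, hyA⟩ : A) ∈ s } => (s : Set A))
    (hU := fun z hz => hO.mem_nhds (hsub hz)) (by
      intro s t
      refine ⟨⟨s ∩ t, s.2.1.inter t.2.1, s.2.2, t.2.2⟩, inter_subset_left, inter_subset_right⟩)
    (fun s => s.2.1.isClosed.isCompact) (fun s => s.2.1.isClosed)
  have hclopen : IsClopen ((↑) '' (Z : Set A) : Set X) := by
    constructor
    · exact (Z.2.1.isClosed.isCompact.image continuous_subtype_val).isClosed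
    · obtain ⟨O, hO1, hO2⟩ := isOpen_induced_iff.1 Z.2.1.isOpen
      have : ((↑) '' (Z : Set A) : Set X) = O ∩ Metric.ball x ε := by
        ext z
        constructor
        · rintro ⟨z, hz, rfl⟩
          refine ⟨?_, hZ hz⟩
          rw [← hO2] at hz
          exact hz
        · rintro ⟨hz1, hz2⟩
          refine ⟨⟨z, Metric.ball_subset_closedBall hz2⟩, ?_, rfl⟩
          rw [← hO2]
          exact hz1
      rw [this]
      exact hO1.inter Metric.isOpen_ball
  have huniv := hclopen.eq_univ ⟨y, ⟨y, hyA⟩, Z.2.2, rfl⟩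
  obtain ⟨z, hz, hzw⟩ : w ∈ ((↑) '' (Z : Set A) : Set X) := huniv ▸ mem_univ w
  have := hZ hz
  simp only [mem_setOf_eq] at this
  rw [hzw] at this
  linarith

/-- local connectedness -/
lemma loc_conn [CompactSpace X] [ConnectedSpace X] (h1 : μH[1] (Set.univ : Set X) < ⊤)
    (x : X) {ε : ℝ} (hε : 0 < ε) :
    ∃ δ > 0, ∀ y, dist y x < δ → ∃ K : Set X, IsCompact K ∧ IsPreconnected K ∧ x ∈ K ∧ y ∈ K ∧
      K ⊆ Metric.closedBall x ε := by
  by_cases hw : ∃ w, ε ≤ dist w x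
  swap
  · push Not at hw
    exact ⟨1, one_pos, fun y _ => ⟨univ, isCompact_univ, isPreconnected_univ, mem_univ _, mem_univ _,
      fun z _ => (hw z).le⟩⟩
  obtain ⟨w, hw⟩ := hw
  set A := Metric.closedBall x ε with hA
  have hxA : x ∈ A := Metric.mem_closedBall_self hε.le
  let I : Set (Set X) := {C | ∃ y, dist y x < ε/2 ∧ C = connectedComponentIn A y}
  have hclosed : ∀ y ∈ A, IsClosed (connectedComponentIn A y) := by
    intro y hy
    refine isClosed_of_closure_subset ?_
    refine isPreconnected_connectedComponentIn.closure.subset_connectedComponentIn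
      (subset_closure (mem_connectedComponentIn hy)) ?_
    exact closure_minimal (connectedComponentIn_subset _ _) Metric.isClosed_closedBall
  have hIfin : I.Finite := by
    have h := Measure.finite_const_le_meas_of_disjoint_iUnion (μH[1] : Measure X)
      (ε := ENNReal.ofReal (ε/2)) (by simpa using hε) (As := fun t : I => (t : Set X))
      (by
        rintro ⟨_, y, hy, rfl⟩
        exact (hclosed y (Metric.mem_closedBall.2 (by linarith))).measurableSet) (by
        rintro ⟨_, y, hy, rfl⟩ ⟨_, z, hz, rfl⟩ hne
        rw [Function.onFun, Set.disjoint_iff_inter_eq_empty]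
        by_contra hcon
        obtain ⟨a, ha, hb⟩ := Set.nonempty_iff_ne_empty.2 hcon
        apply hne
        ext1
        exact (connectedComponentIn_eq ha).trans (connectedComponentIn_eq hb).symm)
      ((measure_mono (subset_univ _)).trans_lt h1).ne
    have h2 : {i : I | ENNReal.ofReal (ε/2) ≤ μH[1] (i : Set X)} = univ := by
      refine eq_univ_of_forall ?_
      rintro ⟨_, y, hy, rfl⟩
      obtain ⟨z, hz, hzx⟩ := bump hw (by linarith : dist y x < ε)
      have hyA : y ∈ A := Metric.mem_closedBall.2 (by linarith)
      have := conn_ball isPreconnected_connectedComponentIn (mem_connectedComponentIn hyA) hz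
        (r := ε/2) (by linarith [dist_triangle z y x])
      exact this.trans (measure_mono inter_subset_left)
    rw [h2] at h
    have := Set.finite_univ_iff.1 h
    exact Set.toFinite _
  let U : Set X := ⋃₀ {C ∈ I | x ∉ C}
  have hU : IsClosed U := by
    rw [show U = ⋃ C ∈ {C ∈ I | x ∉ C}, C from sUnion_eq_biUnion]
    refine (hIfin.subset (sep_subset _ _)).isClosed_biUnion ?_
    rintro _ ⟨⟨y, hy, rfl⟩, -⟩
    exact hclosed y (Metric.mem_closedBall.2 (by linarith))
  have hxU : x ∉ U := by
    rintro ⟨C, ⟨-, hC⟩, hx⟩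
    exact hC hx
  obtain ⟨δ, hδ, hball⟩ := Metric.isOpen_iff.1 hU.isOpen_compl x hxU
  refine ⟨min δ (ε/2), lt_min hδ (by linarith), fun y hy => ?_⟩
  have hy1 := hy.trans_le (min_le_left _ _)
  have hy2 := hy.trans_le (min_le_right _ _)
  have hyA : y ∈ A := Metric.mem_closedBall.2 (by linarith)
  refine ⟨connectedComponentIn A y, (hclosed y hyA).isCompact, isPreconnected_connectedComponentIn, ?_,
    mem_connectedComponentIn hyA, connectedComponentIn_subset _ _⟩
  by_contra hx
  exact hball hy1 ⟨_, ⟨⟨y, hy2, rfl⟩, hx⟩, mem_connectedComponentIn hyA⟩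

end Geometry

section Curves
variable {X : Type*} [MetricSpace X]

lemma ulim_curve {K : Set X} (hK : IsCompact K) (f : ℕ → ℝ → X) (hfK : ∀ n t, f n t ∈ K)
    (δ : ℕ → ℝ) (hδ : Tendsto δ atTop (𝓝 0))
    (hf : ∀ n s t, dist (f n s) (f n t) ≤ |s - t| + δ n) {x y : X} {L : ℝ}
    (h0 : Tendsto (fun n => f n 0) atTop (𝓝 x)) (hL : Tendsto (fun n => f n L) atTop (𝓝 y)) :
    ∃ g : ℝ → X, LipschitzWith 1 g ∧ (∀ t, g t ∈ K) ∧ g 0 = x ∧ g L = y := by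
  have hU : (hyperfilter ℕ : Filter ℕ) ≤ atTop := Nat.hyperfilter_le_atTop
  have key : ∀ t, ∃ a ∈ K, Tendsto (fun n => f n t) (hyperfilter ℕ) (𝓝 a) := by
    intro t
    obtain ⟨a, ha, h⟩ := hK.ultrafilter_le_nhds ((hyperfilter ℕ).map (fun n => f n t))
      (by
        rw [le_principal_iff]
        exact (Filter.univ_mem' (fun n => hfK n t) : {n | f n t ∈ K} ∈ (hyperfilter ℕ : Filter ℕ)))
    exact ⟨a, ha, h⟩
  choose g hgK hg using key
  refine ⟨g, LipschitzWith.of_dist_le_mul fun s t => ?_, hgK,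
    tendsto_nhds_unique (hg 0) (h0.mono_left hU), tendsto_nhds_unique (hg L) (hL.mono_left hU)⟩
  have h1 := (hg s).dist (hg t)
  have h2 : Tendsto (fun n => |s - t| + δ n) (hyperfilter ℕ) (𝓝 (|s - t| + 0)) :=
    (hδ.mono_left hU).const_add _
  have := le_of_tendsto_of_tendsto' h1 h2 (fun n => hf n s t)
  simpa [Real.dist_eq] using this

variable [MeasurableSpace X] [BorelSpace X]

lemma chain {K : Set X} (hK : IsCompact K) (hc : IsPreconnected K) (hfin : μH[1] K < ⊤)
    {x y : X} (hx : x ∈ K) (hy : y ∈ K) {δ : ℝ} (hδ : 0 < δ) :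
    ∃ (N : ℕ) (z : ℕ → X), (∀ i, z i ∈ K) ∧ z 0 = x ∧ (∀ i, N ≤ i → z i = y) ∧
      (∀ i, dist (z i) (z (i+1)) ≤ δ) ∧ N * δ ≤ 4 * (μH[1] K).toReal + δ := by
  classical
  let G : SimpleGraph K :=
    { Adj := fun a b => a ≠ b ∧ dist a b < δ
      symm := ⟨fun a b h => ⟨h.1.symm, by rw [dist_comm]; exact h.2⟩⟩
      loopless := ⟨fun a h => h.1 rfl⟩ }
  have hstep : ∀ a b c : K, G.Reachable a b → dist b c < δ → G.Reachable a c := by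
    intro a b c hab hbc
    by_cases h : b = c
    · exact h ▸ hab
    · exact hab.trans (SimpleGraph.Adj.reachable (G := G) ⟨h, hbc⟩)
  have : PreconnectedSpace K := isPreconnected_iff_preconnectedSpace.1 hc
  have hconn : ∀ a b : K, G.Reachable a b := by
    intro a
    have hcl : IsClopen {b | G.Reachable a b} := by
      constructor
      · rw [← isOpen_compl_iff, Metric.isOpen_iff]
        intro b hb
        refine ⟨δ, hδ, fun c hc h => hb ?_⟩
        exact hstep a c b h hc
      · rw [Metric.isOpen_iff]
        intro b hb
        refine ⟨δ, hδ, fun c hc => ?_⟩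
        exact hstep a b c hb (by rw [dist_comm]; exact hc)
    have := hcl.eq_univ ⟨a, SimpleGraph.Reachable.refl a⟩
    intro b
    exact (this ▸ mem_univ b : b ∈ {b | G.Reachable a b})
  obtain ⟨p, hp⟩ := (hconn ⟨x, hx⟩ ⟨y, hy⟩).exists_walk_length_eq_dist
  have hne : Nonempty K := ⟨⟨x, hx⟩⟩
  have hG : G.Connected := ⟨hconn⟩
  set N := p.length with hN
  have hρ : ∀ i ≤ N, G.dist ⟨x, hx⟩ (p.getVert i) = i := by
    intro i hi
    have h1 := SimpleGraph.dist_le (p.take i)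
    have h2 := SimpleGraph.dist_le (p.drop i)
    have h3 := hG.dist_triangle (u := ⟨x, hx⟩) (v := p.getVert i) (w := ⟨y, hy⟩)
    simp only [SimpleGraph.Walk.take_length, SimpleGraph.Walk.drop_length] at h1 h2
    omega
  have hfar : ∀ i j, i ≤ N → j ≤ N → i + 2 ≤ j → δ ≤ dist (p.getVert i) (p.getVert j) := by
    intro i j hi hj hij
    by_contra hlt
    push Not at hlt
    have h1 := hρ i hi
    have h2 := hρ j hj
    have hadj : G.Adj (p.getVert i) (p.getVert j) := by
      refine ⟨fun h => ?_, hlt⟩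
      rw [h] at h1
      omega
    have h3 := hG.dist_triangle (u := ⟨x, hx⟩) (v := p.getVert i) (w := p.getVert j)
    rw [SimpleGraph.dist_eq_one_iff_adj.2 hadj] at h3
    omega
  refine ⟨N, fun i => p.getVert i, fun i => (p.getVert i).2, by simp, ?_, ?_, ?_⟩
  · intro i hi
    simp [p.getVert_of_length_le hi]
  · intro i
    by_cases hi : i < N
    · exact (p.adj_getVert_succ hi).2.le
    · dsimp only
      rw [p.getVert_of_length_le (by omega), p.getVert_of_length_le (by omega)]
      simpa using hδ.le
  · by_cases hN2 : N < 2
    · have : (N:ℝ) ≤ 1 := by exact_mod_cast (by omega : N ≤ 1)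
      nlinarith [ENNReal.toReal_nonneg (a := μH[1] K)]
    push Not at hN2
    have hxy : δ ≤ dist x y := by
      have := hfar 0 N (by omega) le_rfl (by omega)
      simpa [hN, Subtype.dist_eq] using this
    have hball : ∀ z ∈ K, ENNReal.ofReal (δ/2) ≤ μH[1] (K ∩ Metric.ball z (δ/2)) := by
      intro z hz
      by_cases h : δ/2 ≤ dist x z
      · exact conn_ball hc hz hx h
      · exact conn_ball hc hz hy (by linarith [dist_triangle x z y, dist_comm y z])
    have hsum : ∑ i ∈ Finset.range (N/2+1), μH[1] (K ∩ Metric.ball (p.getVert (2*i) : X) (δ/2)) ≤ μH[1] K := by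
      rw [← measure_biUnion_finset]
      · exact measure_mono (iUnion₂_subset fun i _ => inter_subset_left)
      · have main : ∀ i j, i ∈ Finset.range (N/2+1) → j ∈ Finset.range (N/2+1) → i < j →
          Disjoint (K ∩ Metric.ball (p.getVert (2*i) : X) (δ/2)) (K ∩ Metric.ball (p.getVert (2*j) : X) (δ/2)) := by
          intro i j hi hj hij
          simp only [Finset.mem_range] at hi hj
          refine Disjoint.mono inter_subset_right inter_subset_right ?_
          apply Metric.ball_disjoint_ball
          have := hfar (2*i) (2*j) (by omega) (by omega) (by omega)
          rw [Subtype.dist_eq] at this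
          linarith
        intro i hi j hj hij
        rcases lt_or_gt_of_ne hij with h | h
        · exact main i j hi hj h
        · exact (main j i hj hi h).symm
      · intro i _
        exact hK.measurableSet.inter Metric.isOpen_ball.measurableSet
    have h3 : ((N/2+1 : ℕ) : ℝ≥0∞) * ENNReal.ofReal (δ/2) ≤ μH[1] K := by
      refine le_trans ?_ hsum
      rw [← nsmul_eq_mul]
      have := Finset.card_nsmul_le_sum (Finset.range (N/2+1)) (fun i => μH[1] (K ∩ Metric.ball (p.getVert (2*i) : X) (δ/2))) (ENNReal.ofReal (δ/2)) (fun i _ => hball _ (p.getVert (2*i)).2)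
      simpa using this
    have h4 := ENNReal.toReal_mono hfin.ne h3
    rw [ENNReal.toReal_mul, ENNReal.toReal_natCast, ENNReal.toReal_ofReal (by linarith)] at h4
    have h5 : (N:ℝ) ≤ 2 * ((N/2+1 : ℕ) : ℝ) := by exact_mod_cast (by omega : N ≤ 2 * (N/2+1))
    nlinarith

lemma exists_lip {K : Set X} (hK : IsCompact K) (hc : IsPreconnected K) (hfin : μH[1] K < ⊤)
    {x y : X} (hx : x ∈ K) (hy : y ∈ K) :
    ∃ L : ℝ, 0 ≤ L ∧ ∃ g : ℝ → X, LipschitzWith 1 g ∧ (∀ t, g t ∈ K) ∧ g 0 = x ∧ g L = y := by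
  have hd : ∀ n : ℕ, (0:ℝ) < 1 / (n+1) := fun n => by positivity
  choose N z hzK hz0 hzN hzd hNd using fun n : ℕ => chain hK hc hfin hx hy (hd n)
  set M := (μH[1] K).toReal
  have hM : 0 ≤ M := ENNReal.toReal_nonneg
  refine ⟨4 * M + 1, by linarith, ?_⟩
  have hdist : ∀ n i j, i ≤ j → dist (z n i) (z n j) ≤ (j - i : ℝ) * (1 / (n+1)) := by
    intro n i j hij
    induction j, hij using Nat.le_induction with
    | base => simp
    | succ j hij ih =>
      have h1 := dist_triangle (z n i) (z n j) (z n (j+1))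
      have h2 := hzd n j
      push_cast
      linarith
  have hfl : ∀ n (s t : ℝ), s ≤ t → dist (z n ⌊s * (n+1)⌋₊) (z n ⌊t * (n+1)⌋₊) ≤ |s - t| + 1 / ((n:ℝ)+1) := by
    intro n s t hst
    have hn : (0:ℝ) < n + 1 := by positivity
    have hmul : s * (n+1) ≤ t * (n+1) := by gcongr
    refine (hdist n _ _ (Nat.floor_mono hmul)).trans ?_
    have h1 : ((⌊t * (n+1)⌋₊ : ℝ) - ⌊s * (n+1)⌋₊) ≤ (t - s) * (n+1) + 1 := by
      rcases le_or_gt 0 t with ht | ht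
      · have := Nat.floor_le (a := t * ((n:ℝ)+1)) (by positivity)
        have := Nat.lt_floor_add_one (s * ((n:ℝ)+1))
        linarith
      · rw [Nat.floor_of_nonpos (by nlinarith), Nat.floor_of_nonpos (by nlinarith)]
        have : 0 ≤ (t - s) * ((n:ℝ)+1) := by nlinarith
        simp; linarith
    have h2 : |s - t| = t - s := by rw [abs_sub_comm, abs_of_nonneg (by linarith)]
    rw [h2]
    calc _ ≤ ((t - s) * (n+1) + 1) * (1 / ((n:ℝ)+1)) := by gcongr
      _ = _ := by field_simp
  refine ulim_curve hK (fun n t => z n ⌊t * (n+1)⌋₊) (fun n t => hzK n _) (fun n => 1 / ((n:ℝ)+1))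
    tendsto_one_div_add_atTop_nhds_zero_nat ?_ ?_ ?_
  · intro n s t
    rcases le_total s t with h | h
    · exact hfl n s t h
    · rw [dist_comm, abs_sub_comm]; exact hfl n t s h
  · simp [hz0]
  · refine tendsto_const_nhds.congr fun n => ?_
    symm
    apply hzN
    apply Nat.le_floor
    have := hNd n
    have hn : (0:ℝ) < n + 1 := by positivity
    have h1 : (1:ℝ)/(n+1) ≤ 1 := by rw [div_le_one hn]; linarith [(Nat.cast_nonneg n : (0:ℝ) ≤ n)]
    rw [mul_one_div, div_le_iff₀ hn] at this
    nlinarith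

end Curves

section Simple
variable {X : Type*} [MetricSpace X]

lemma evar_le {g : ℝ → X} (hg : LipschitzWith 1 g) {s t : ℝ} (hst : s ≤ t) :
    eVariationOn g (Icc s t) ≤ ENNReal.ofReal (t - s) := by
  have h1 := (hg.lipschitzOnWith (s := univ)).comp_eVariationOn_le (g := fun x : ℝ => x) (s := Icc s t)
    (mapsTo_univ _ _)
  have h2 := (monotone_id (α := ℝ)).monotoneOn (Icc s t) |>.eVariationOn_le
    (left_mem_Icc.2 hst) (right_mem_Icc.2 hst)
  simp only [inter_self, ENNReal.coe_one, one_mul] at h1 h2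
  exact h1.trans h2

lemma evar_add {g : ℝ → X} {s t r : ℝ} (hst : s ≤ t) (htr : t ≤ r) :
    eVariationOn g (Icc s t) + eVariationOn g (Icc t r) = eVariationOn g (Icc s r) := by
  have := eVariationOn.Icc_add_Icc g (s := univ) hst htr (mem_univ _)
  simpa using this

lemma exists_simple_aux {K : Set X} (hK : IsCompact K) {x y : X}
    (hL : ∃ L : ℝ, 0 ≤ L ∧ ∃ g : ℝ → X, LipschitzWith 1 g ∧ (∀ t, g t ∈ K) ∧ g 0 = x ∧ g L = y) :
    ∃ γ : MCurve X, γ.IsSimple ∧ γ.image ⊆ K ∧ γ.toFun 0 = x ∧ γ.toFun γ.len = y := by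
  set S : Set ℝ := {L | 0 ≤ L ∧ ∃ g : ℝ → X, LipschitzWith 1 g ∧ (∀ t, g t ∈ K) ∧ g 0 = x ∧ g L = y} with hS
  have hSne : S.Nonempty := hL
  have hbdd : BddBelow S := ⟨0, fun L h => h.1⟩
  obtain ⟨l, -, hl, hlS⟩ := exists_seq_tendsto_sInf hSne hbdd
  set L := sInf S with hLdef
  have hL0 : 0 ≤ L := ge_of_tendsto' hl fun n => (hlS n).1
  have hmin : ∀ L' ∈ S, L ≤ L' := fun L' h => csInf_le hbdd h
  choose f hf hfK hf0 hfl using fun n => (hlS n).2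
  obtain ⟨g, hg, hgK, hg0, hgL⟩ := ulim_curve hK f hfK (fun _ => 0) tendsto_const_nhds
    (fun n s t => by simpa [Real.dist_eq] using (hf n).dist_le_mul s t) (x := x) (y := y) (L := L)
    (tendsto_const_nhds.congr fun n => (hf0 n).symm) (by
      rw [tendsto_iff_dist_tendsto_zero]
      have : Tendsto (fun n => |L - l n|) atTop (𝓝 0) := by
        have := (tendsto_const_nhds (x := L)).sub hl
        simpa using this.abs
      refine squeeze_zero (fun _ => dist_nonneg) (fun n => ?_) this
      have := (hf n).dist_le_mul L (l n)
      rw [hfl n] at this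
      simpa [Real.dist_eq] using this)
  have hfinv : ∀ s t, s ≤ t → eVariationOn g (Icc s t) ≠ ⊤ := fun s t h =>
    ((evar_le hg h).trans_lt ENNReal.ofReal_lt_top).ne
  let φ : ℝ → ℝ := fun t => (eVariationOn g (Icc 0 t)).toReal
  have hφadd : ∀ s t, 0 ≤ s → s ≤ t → φ t = φ s + (eVariationOn g (Icc s t)).toReal := by
    intro s t hs hst
    simp only [φ]
    rw [← evar_add hs hst, ENNReal.toReal_add (hfinv _ _ hs) (hfinv _ _ hst)]
  have hvle : ∀ s t, s ≤ t → (eVariationOn g (Icc s t)).toReal ≤ t - s := by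
    intro s t hst
    exact ENNReal.toReal_le_of_le_ofReal (by linarith) (evar_le hg hst)
  have hφ0 : φ 0 = 0 := by
    have := hvle 0 0 le_rfl
    have h2 : 0 ≤ φ 0 := ENNReal.toReal_nonneg
    simp only [φ] at *
    linarith
  have hdφ' : ∀ s t, 0 ≤ s → s ≤ t → dist (g s) (g t) ≤ |φ s - φ t| := by
    intro s t hs hst
    have h1 := eVariationOn.edist_le g (left_mem_Icc.2 hst) (right_mem_Icc.2 hst)
    have h2 := ENNReal.toReal_mono (hfinv s t hst) h1
    rw [edist_dist, ENNReal.toReal_ofReal dist_nonneg] at h2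
    rw [abs_sub_comm]
    have := le_abs_self (φ t - φ s)
    linarith [hφadd s t hs hst]
  have hdφ : ∀ s t, 0 ≤ s → 0 ≤ t → dist (g s) (g t) ≤ |φ s - φ t| := by
    intro s t hs ht
    rcases le_total s t with h | h
    · exact hdφ' s t hs h
    · rw [dist_comm, abs_sub_comm]; exact hdφ' t s ht h
  have hφc : ContinuousOn φ (Icc 0 L) := by
    have hl : LipschitzOnWith 1 φ (Icc 0 L) := by
      refine LipschitzOnWith.of_dist_le_mul fun s hs t ht => ?_
      have main : ∀ s t, 0 ≤ s → s ≤ t → |φ s - φ t| ≤ |s - t| := by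
        intro s t hs hst
        have h1 := hφadd s t hs hst
        have h2 := hvle s t hst
        have h3 := ENNReal.toReal_nonneg (a := eVariationOn g (Icc s t))
        rw [abs_sub_comm, abs_sub_comm s, abs_of_nonneg (by linarith), abs_of_nonneg (by linarith)]
        linarith
      simp only [Real.dist_eq, NNReal.coe_one, one_mul]
      rcases le_total s t with h | h
      · exact main s t hs.1 h
      · rw [abs_sub_comm, abs_sub_comm s]; exact main t s ht.1 h
    exact hl.continuousOn
  have hV0 : 0 ≤ φ L := ENNReal.toReal_nonneg
  have hLV : L ≤ φ L := by
    apply hmin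
    refine ⟨hV0, ?_⟩
    have hsurj : ∀ a : ℝ, ∃ t ∈ Icc 0 L, φ t = max 0 (min a (φ L)) := by
      intro a
      have := intermediate_value_Icc hL0 hφc
      rw [hφ0] at this
      exact this ⟨le_max_left _ _, max_le hV0 (min_le_right _ _)⟩
    choose ψ hψ hφψ using hsurj
    refine ⟨g ∘ ψ, LipschitzWith.of_dist_le_mul fun a b => ?_, fun t => hgK _, ?_, ?_⟩
    · refine (hdφ _ _ (hψ a).1 (hψ b).1).trans ?_
      rw [hφψ, hφψ, NNReal.coe_one, one_mul, Real.dist_eq]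
      have h1 := abs_max_sub_max_le_max 0 (min a (φ L)) 0 (min b (φ L))
      have h2 := abs_min_sub_min_le_max a (φ L) b (φ L)
      simp at h1 h2
      linarith
    · have := hdφ (ψ 0) 0 (hψ 0).1 le_rfl
      rw [hφψ, hφ0] at this
      simp [hV0, hg0] at this
      exact this
    · have := hdφ (ψ (φ L)) L (hψ _).1 hL0
      rw [hφψ] at this
      simp [hV0, hgL] at this
      exact this
  refine ⟨⟨L, hL0, g, ?_⟩, ?_, ?_, hg0, hgL⟩
  · intro s t hs ht hst
    refine le_antisymm (evar_le hg hst) ?_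
    rw [ENNReal.ofReal_le_iff_le_toReal (hfinv s t hst)]
    have h1 := hφadd s t hs.1 hst
    have h2 := hφadd t L ht.1 ht.2
    have h3 := hvle t L ht.2
    have h4 := hvle 0 s hs.1
    simp only [φ] at *
    linarith
  · have main : ∀ s t, 0 ≤ s → s < t → t ≤ L → g s ≠ g t := by
      intro s t hs hst ht heq
      have : L - (t - s) ∈ S := by
        refine ⟨by linarith, fun a => g (if a ≤ s then a else a + (t - s)), ?_, fun _ => hgK _, ?_, ?_⟩
        · have hcut : ∀ a b, a ≤ b → dist (g (if a ≤ s then a else a + (t - s)))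
              (g (if b ≤ s then b else b + (t - s))) ≤ |a - b| := by
            intro a b hab
            have hgd : ∀ a b, dist (g a) (g b) ≤ |a - b| := fun a b => by
              simpa [Real.dist_eq] using hg.dist_le_mul a b
            by_cases ha : a ≤ s
            · by_cases hb : b ≤ s
              · rw [if_pos ha, if_pos hb]; exact hgd a b
              · rw [if_pos ha, if_neg hb]
                have h1 := dist_triangle (g a) (g s) (g (b + (t - s)))
                have h2 := hgd a s
                have h3 := hgd t (b + (t-s))
                rw [← heq] at h3
                push Not at hb
                rw [abs_sub_comm, abs_of_nonneg (by linarith)] at h2 h3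
                rw [abs_sub_comm, abs_of_nonneg (by linarith)]
                linarith
            · rw [if_neg ha, if_neg (by linarith)]
              have := hgd (a + (t-s)) (b + (t - s))
              simpa using this
          refine LipschitzWith.of_dist_le_mul fun a b => ?_
          rw [NNReal.coe_one, one_mul, Real.dist_eq]
          rcases le_total a b with h | h
          · exact hcut a b h
          · rw [dist_comm, abs_sub_comm]; exact hcut b a h
        · simp [hs, hg0]
        · by_cases h : L - (t - s) ≤ s
          · have : t = L := by linarith
            simp only [if_pos h]
            rw [show L - (t - s) = s by linarith, heq, this, hgL]
          · simp only [if_neg h]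
            rw [sub_add_cancel, hgL]
      have := hmin _ this
      linarith
    intro s hs t ht heq
    rcases lt_trichotomy s t with h | h | h
    · exact absurd heq (main s t hs.1 h ht.2)
    · exact h
    · exact absurd heq.symm (main t s ht.1 h hs.2)
  · rintro _ ⟨t, -, rfl⟩
    exact hgK t

variable [MeasurableSpace X] [BorelSpace X]

lemma exists_simple {K : Set X} (hK : IsCompact K) (hc : IsPreconnected K)
    (h1 : μH[1] (univ : Set X) < ⊤) {x y : X} (hx : x ∈ K) (hy : y ∈ K) :
    ∃ γ : MCurve X, γ.IsSimple ∧ γ.image ⊆ K ∧ γ.toFun 0 = x ∧ γ.toFun γ.len = y :=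
  exists_simple_aux hK (exists_lip hK hc ((measure_mono (subset_univ _)).trans_lt h1) hx hy)

lemma loc_arc [CompactSpace X] [ConnectedSpace X] (h1 : μH[1] (Set.univ : Set X) < ⊤)
    (x : X) {ε : ℝ} (hε : 0 < ε) :
    ∃ δ > 0, ∀ y, dist y x < δ → ∃ γ : MCurve X, γ.IsSimple ∧ γ.image ⊆ Metric.ball x ε ∧
      γ.toFun 0 = x ∧ γ.toFun γ.len = y := by
  obtain ⟨δ, hδ, h⟩ := loc_conn h1 x (half_pos hε)
  refine ⟨δ, hδ, fun y hy => ?_⟩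
  obtain ⟨K, hK, hKc, hx, hy, hsub⟩ := h y hy
  obtain ⟨γ, hγ, hi, h0, hl⟩ := exists_simple hK hKc h1 hx hy
  exact ⟨γ, hγ, hi.trans (hsub.trans (Metric.closedBall_subset_ball (by linarith))), h0, hl⟩

end Simple

section Var
variable {X : Type*} [MetricSpace X]

lemma le_pVar (v : X → ℝ) {ι : Type*} [Fintype ι] (γ : ι → MCurve X) (h : ∀ i, (γ i).IsSimple)
    (hd : ∀ i j, i ≠ j → Disjoint (γ i).image (γ j).image) :
    ∑ i, ENNReal.ofReal |v ((γ i).toFun (γ i).len) - v ((γ i).toFun 0)| ≤ pVar v := by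
  let e := Fintype.equivFin ι
  have h1 : ∑ i, ENNReal.ofReal |v ((γ i).toFun (γ i).len) - v ((γ i).toFun 0)| =
      ∑ k, ENNReal.ofReal |v ((γ (e.symm k)).toFun (γ (e.symm k)).len) - v ((γ (e.symm k)).toFun 0)| :=
    (Equiv.sum_comp e.symm (fun i => ENNReal.ofReal |v ((γ i).toFun (γ i).len) - v ((γ i).toFun 0)|)).symm
  rw [h1]
  exact le_iSup_of_le (Fintype.card ι) (le_iSup_of_le (fun k => γ (e.symm k))
    (le_iSup_of_le (fun k => h _) (le_iSup_of_le (fun i j hij => hd _ _ (fun h => hij (e.symm.injective h))) le_rfl)))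

lemma pVar_le (v : X → ℝ) (B : ℝ≥0∞) (h : ∀ (n : ℕ) (γ : Fin n → MCurve X), (∀ i, (γ i).IsSimple) →
    (∀ i j, i ≠ j → Disjoint (γ i).image (γ j).image) →
    ∑ i, ENNReal.ofReal |v ((γ i).toFun (γ i).len) - v ((γ i).toFun 0)| ≤ B) : pVar v ≤ B :=
  iSup_le fun n => iSup_le fun γ => iSup_le fun h1 => iSup_le fun h2 => h n γ h1 h2

lemma MCurve.contOn (γ : MCurve X) : ContinuousOn γ.toFun (Icc 0 γ.len) := by
  have : LipschitzOnWith 1 γ.toFun (Icc 0 γ.len) := by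
    have main : ∀ s ∈ Icc 0 γ.len, ∀ t ∈ Icc 0 γ.len, s ≤ t → edist (γ.toFun s) (γ.toFun t) ≤ edist s t := by
      intro s hs t ht hst
      have h1 := eVariationOn.edist_le γ.toFun (left_mem_Icc.2 hst) (right_mem_Icc.2 hst)
      rw [γ.arclength s t hs ht hst] at h1
      rwa [edist_comm s, edist_dist t s, Real.dist_eq, abs_of_nonneg (by linarith)]
    intro s hs t ht
    rw [ENNReal.coe_one, one_mul]
    rcases le_total s t with h | h
    · exact main s hs t ht h
    · rw [edist_comm, edist_comm s]; exact main t ht s hs h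
  exact this.continuousOn

lemma MCurve.image_compact (γ : MCurve X) : IsCompact γ.image := isCompact_Icc.image_of_continuousOn γ.contOn

lemma MCurve.image_conn (γ : MCurve X) : IsPreconnected γ.image := isPreconnected_Icc.image _ γ.contOn

lemma MCurve.zero_mem (γ : MCurve X) : γ.toFun 0 ∈ γ.image := ⟨0, left_mem_Icc.2 γ.len_nonneg, rfl⟩

lemma MCurve.len_mem (γ : MCurve X) : γ.toFun γ.len ∈ γ.image := ⟨γ.len, right_mem_Icc.2 γ.len_nonneg, rfl⟩

variable [MeasurableSpace X] [BorelSpace X]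

/-- the cone function -/
noncomputable def cone (x : X) (r : ℝ) (y : X) : ℝ := 1 - min (dist y x) r / r

lemma cone_cont (x : X) (r : ℝ) : Continuous (cone x r) := by
  unfold cone; fun_prop

lemma cone_curve {x : X} {r : ℝ} (hr : 0 < r) (γ : MCurve X) :
    ENNReal.ofReal (|cone x r (γ.toFun γ.len) - cone x r (γ.toFun 0)| * r) ≤
      μH[1] (γ.image ∩ Metric.ball x r) := by
  have hlip : LipschitzWith 1 (fun y : X => min (dist y x) r) := (LipschitzWith.dist_left x).min_const r
  have main : ∀ p ∈ γ.image, ∀ q ∈ γ.image, min (dist p x) r ≤ min (dist q x) r →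
      ENNReal.ofReal (|cone x r q - cone x r p| * r) ≤ μH[1] (γ.image ∩ Metric.ball x r) := by
    intro p hp q hq hpq
    have := conn_lower γ.image_conn hlip hp hq (a := min (dist p x) r) (b := min (dist q x) r) le_rfl le_rfl
    have heq : |cone x r q - cone x r p| * r = min (dist q x) r - min (dist p x) r := by
      have : cone x r q - cone x r p = - ((min (dist q x) r - min (dist p x) r) / r) := by
        unfold cone; ring
      rw [this, abs_neg, abs_of_nonneg (div_nonneg (by linarith) hr.le)]
      field_simp
    rw [heq]
    refine this.trans (measure_mono ?_)
    rintro z ⟨hz, hz2⟩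
    refine ⟨hz, ?_⟩
    have h3 : min (dist z x) r < r := hz2.2.trans_le (min_le_right _ _)
    rcases min_lt_iff.1 h3 with h | h
    · exact h
    · exact absurd h (lt_irrefl _)
  rcases le_total (min (dist (γ.toFun 0) x) r) (min (dist (γ.toFun γ.len) x) r) with h | h
  · exact main _ γ.zero_mem _ γ.len_mem h
  · rw [abs_sub_comm]; exact main _ γ.len_mem _ γ.zero_mem h

lemma cone_var {x : X} {r : ℝ} (hr : 0 < r) {n : ℕ} (γ : Fin n → MCurve X)
    (hd : ∀ i j, i ≠ j → Disjoint (γ i).image (γ j).image) :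
    ∑ i, ENNReal.ofReal |cone x r ((γ i).toFun (γ i).len) - cone x r ((γ i).toFun 0)| ≤
      μH[1] (Metric.ball x r) / ENNReal.ofReal r := by
  rw [ENNReal.le_div_iff_mul_le (Or.inl (by simpa using hr)) (Or.inl ENNReal.ofReal_ne_top), Finset.sum_mul]
  calc _ ≤ ∑ i, μH[1] ((γ i).image ∩ Metric.ball x r) := by
        refine Finset.sum_le_sum fun i _ => ?_
        rw [← ENNReal.ofReal_mul (abs_nonneg _)]
        exact cone_curve hr (γ i)
    _ = μH[1] (⋃ i ∈ Finset.univ, (γ i).image ∩ Metric.ball x r) := by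
        rw [measure_biUnion_finset]
        · intro i _ j _ hij
          exact (hd i j hij).mono inter_subset_left inter_subset_left
        · intro i _
          exact (γ i).image_compact.measurableSet.inter Metric.isOpen_ball.measurableSet
    _ ≤ _ := measure_mono (iUnion₂_subset fun i _ => inter_subset_right)

/-- oscillation of `v` at `x` is at most `c` -/
def OscLe (v : X → ℝ) (x : X) (c : ℝ) : Prop := ∀ η > 0, ∀ᶠ y in 𝓝 x, |v y - v x| ≤ c + η

lemma OscLe.continuousAt {v : X → ℝ} {x : X} (h : OscLe v x 0) : ContinuousAt v x := by
  rw [Metric.continuousAt_iff']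
  intro ε hε
  filter_upwards [h (ε/2) (half_pos hε)] with y hy
  rw [Real.dist_eq]; linarith

lemma step {C₀ : ℝ} (hC₀ : 0 < C₀) {x : X}
    (hdens : Filter.liminf
      (fun r : ℝ => μH[1] (Metric.ball x r) / ENNReal.ofReal r) (𝓝[>] 0) < ENNReal.ofReal C₀)
    (v : X → ℝ) {c : ℝ} (hc : 0 ≤ c) (hv : OscLe v x c) {ε : ℝ} (hε : 0 < ε) :
    ∃ v' : X → ℝ, OscLe v' x 0 ∧ (∀ z d, 0 ≤ d → OscLe v z d → OscLe v' z d) ∧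
      (∀ y, |v' y - v y| ≤ c + ε) ∧
      (∃ U : Set X, (∀ y ∉ U, v' y = v y) ∧ μH[1] U ≤ ENNReal.ofReal ε) ∧
      pVar v' ≤ pVar v + ENNReal.ofReal ((c + ε) * C₀) := by
  obtain ⟨ρ, hρ, hball⟩ := Metric.eventually_nhds_iff.1 (hv ε hε)
  have hfreq := Filter.frequently_lt_of_liminf_lt (by isBoundedDefault) hdens
  have hev : ∀ᶠ r : ℝ in 𝓝[>] 0, 0 < r ∧ r < min ρ (ε / C₀) := by
    have := Ioo_mem_nhdsGT (lt_min hρ (div_pos hε hC₀))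
    filter_upwards [this] with r hr using hr
  obtain ⟨r, hr1, hr0, hr2⟩ := (hfreq.and_eventually hev).exists
  have hrρ := hr2.trans_le (min_le_left _ _)
  have hrε := hr2.trans_le (min_le_right _ _)
  set η := cone x r with hη
  have hη0 : ∀ y, 0 ≤ η y := fun y => by
    simp only [hη, cone, sub_nonneg]
    rw [div_le_one hr0]; exact min_le_right _ _
  have hη1 : ∀ y, η y ≤ 1 := fun y => by
    simp only [hη, cone]
    have : 0 ≤ min (dist y x) r / r := div_nonneg (le_min dist_nonneg hr0.le) hr0.le
    linarith
  have hηx : η x = 1 := by simp [hη, cone, hr0.le]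
  have hηout : ∀ y, y ∉ Metric.ball x r → η y = 0 := fun y hy => by
    simp only [Metric.mem_ball, not_lt] at hy
    simp [hη, cone, min_eq_right hy, hr0.ne']
  have hηc : Continuous η := cone_cont x r
  have hin : ∀ y ∈ Metric.ball x r, |v y - v x| ≤ c + ε := fun y hy => hball (lt_trans hy hrρ)
  refine ⟨fun y => v y + η y * (v x - v y), ?_, ?_, ?_, ⟨Metric.ball x r, ?_, ?_⟩, ?_⟩
  · intro κ hκ
    have h1 : ∀ᶠ y in 𝓝 x, (1 - η y) * (c + ε) < κ := by
      have : Tendsto (fun y => (1 - η y) * (c + ε)) (𝓝 x) (𝓝 ((1 - η x) * (c + ε))) :=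
        ((continuous_const.sub hηc).mul continuous_const).tendsto x
      rw [hηx, sub_self, zero_mul] at this
      exact this.eventually (gt_mem_nhds hκ)
    filter_upwards [h1, Metric.ball_mem_nhds x hr0] with y hy1 hy2
    have : v y + η y * (v x - v y) - (v x + η x * (v x - v x)) = (1 - η y) * (v y - v x) := by
      rw [hηx]; ring
    rw [this, abs_mul, abs_of_nonneg (by linarith [hη1 y])]
    have := mul_le_mul_of_nonneg_left (hin y hy2) (by linarith [hη1 y] : 0 ≤ 1 - η y)
    linarith
  · intro z d hd hz κ hκ
    have h1 : ∀ᶠ y in 𝓝 z, |η y - η z| * |v x - v z| < κ/2 := by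
      have : Tendsto (fun y => |η y - η z| * |v x - v z|) (𝓝 z) (𝓝 (|η z - η z| * |v x - v z|)) :=
        ((hηc.sub continuous_const).abs.mul continuous_const).tendsto z
      rw [sub_self, abs_zero, zero_mul] at this
      exact this.eventually (gt_mem_nhds (half_pos hκ))
    filter_upwards [h1, hz (κ/2) (half_pos hκ)] with y hy1 hy2
    have : v y + η y * (v x - v y) - (v z + η z * (v x - v z)) =
      (1 - η y) * (v y - v z) + (η y - η z) * (v x - v z) := by ring
    rw [this]
    refine (abs_add_le _ _).trans ?_
    rw [abs_mul, abs_mul, abs_of_nonneg (by linarith [hη1 y] : 0 ≤ 1 - η y)]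
    have := mul_le_of_le_one_left (abs_nonneg (v y - v z)) (by linarith [hη0 y] : 1 - η y ≤ 1)
    linarith
  · intro y
    by_cases hy : y ∈ Metric.ball x r
    · rw [add_sub_cancel_left, abs_mul, abs_of_nonneg (hη0 y), abs_sub_comm]
      exact (mul_le_of_le_one_left (abs_nonneg _) (hη1 y)).trans (hin y hy)
    · simp [hηout y hy]; linarith
  · intro y hy
    simp [hηout y hy]
  · have := (ENNReal.div_le_iff (by simpa using hr0) ENNReal.ofReal_ne_top).1 hr1.le
    refine this.trans ?_
    rw [← ENNReal.ofReal_mul hC₀.le]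
    refine ENNReal.ofReal_le_ofReal ?_
    rw [lt_div_iff₀ hC₀] at hrε
    linarith
  · refine pVar_le _ _ fun n γ h1 h2 => ?_
    have hpt : ∀ p q : X, |v q + η q * (v x - v q) - (v p + η p * (v x - v p))| ≤
        |v q - v p| + (c + ε) * |η q - η p| := by
      intro p q
      have e1 : v q + η q * (v x - v q) - (v p + η p * (v x - v p)) =
        (1 - η q) * (v q - v p) + (η q - η p) * (v x - v p) := by ring
      have e2 : v q + η q * (v x - v q) - (v p + η p * (v x - v p)) =
        (1 - η p) * (v q - v p) + (η q - η p) * (v x - v q) := by ring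
      by_cases hp : p ∈ Metric.ball x r
      · rw [e1]
        refine (abs_add_le _ _).trans ?_
        rw [abs_mul, abs_mul, abs_of_nonneg (by linarith [hη1 q] : 0 ≤ 1 - η q), mul_comm (c + ε)]
        have h3 := hin p hp
        rw [abs_sub_comm] at h3
        exact add_le_add (mul_le_of_le_one_left (abs_nonneg _) (by linarith [hη0 q]))
          (mul_le_mul_of_nonneg_left h3 (abs_nonneg _))
      by_cases hq : q ∈ Metric.ball x r
      · rw [e2]
        refine (abs_add_le _ _).trans ?_
        rw [abs_mul, abs_mul, abs_of_nonneg (by linarith [hη1 p] : 0 ≤ 1 - η p), mul_comm (c + ε)]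
        have h3 := hin q hq
        rw [abs_sub_comm] at h3
        exact add_le_add (mul_le_of_le_one_left (abs_nonneg _) (by linarith [hη0 p]))
          (mul_le_mul_of_nonneg_left h3 (abs_nonneg _))
      · simp [hηout p hp, hηout q hq]
    calc _ ≤ ∑ i, (ENNReal.ofReal |v ((γ i).toFun (γ i).len) - v ((γ i).toFun 0)| +
          ENNReal.ofReal (c + ε) * ENNReal.ofReal |η ((γ i).toFun (γ i).len) - η ((γ i).toFun 0)|) := by
          refine Finset.sum_le_sum fun i _ => ?_
          rw [← ENNReal.ofReal_mul (by linarith), ← ENNReal.ofReal_add (abs_nonneg _) (by positivity)]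
          exact ENNReal.ofReal_le_ofReal (hpt _ _)
      _ ≤ _ := by
          rw [Finset.sum_add_distrib, ← Finset.mul_sum, ENNReal.ofReal_mul (by linarith)]
          exact add_le_add (le_pVar v γ h1 h2) (mul_le_mul_right ((cone_var hr0 γ h2).trans hr1.le) _)

end Var

section Approx
variable {X : Type*} [MetricSpace X] [MeasurableSpace X] [BorelSpace X]

lemma exists_osc [CompactSpace X] [ConnectedSpace X] (h1 : μH[1] (Set.univ : Set X) < ⊤)
    (v : X → ℝ) (hv : pVar v < ⊤) :
    ∃ s : X → ℝ, (∀ x, 0 ≤ s x) ∧ (∀ x, OscLe v x (s x)) ∧ ∑' x, ENNReal.ofReal (s x) ≤ pVar v := by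
  classical
  have hbound : ∀ x y, |v y - v x| ≤ (pVar v).toReal := by
    intro x y
    obtain ⟨γ, hγ, -, h0, hl⟩ := exists_simple isCompact_univ isPreconnected_univ h1 (mem_univ x) (mem_univ y)
    have := le_pVar v (fun _ : Unit => γ) (fun _ => hγ) (fun i j h => absurd (Subsingleton.elim i j) h)
    simp only [Finset.univ_unique, Finset.sum_const, Finset.card_singleton, one_smul, h0, hl] at this
    exact (ENNReal.ofReal_le_iff_le_toReal hv.ne).1 this
  let T : X → Set ℝ := fun x => {c : ℝ | 0 ≤ c ∧ ∀ᶠ y in 𝓝 x, |v y - v x| ≤ c}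
  have hTne : ∀ x, (T x).Nonempty := fun x =>
    ⟨_, ENNReal.toReal_nonneg, Eventually.of_forall fun y => hbound x y⟩
  have hTb : ∀ x, BddBelow (T x) := fun x => ⟨0, fun c hc => hc.1⟩
  have hs0 : ∀ x, 0 ≤ sInf (T x) := fun x => le_csInf (hTne x) fun c hc => hc.1
  refine ⟨fun x => sInf (T x), hs0, ?_, ?_⟩
  · intro x η hη
    obtain ⟨c, hc, hlt⟩ := exists_lt_of_csInf_lt (hTne x) (lt_add_of_pos_right (sInf (T x)) hη)
    filter_upwards [hc.2] with y hy
    linarith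
  · have hfreq : ∀ x κ, 0 < κ → ∃ᶠ y in 𝓝 x, sInf (T x) - κ ≤ |v y - v x| := by
      intro x κ hκ
      by_cases h : sInf (T x) - κ < 0
      · exact (Eventually.of_forall fun y => h.le.trans (abs_nonneg _)).frequently
      · push Not at h
        intro hcon
        have : sInf (T x) - κ ∈ T x := ⟨h, hcon.mono fun y hy => (not_le.1 hy).le⟩
        have := csInf_le (hTb x) this
        linarith
    rw [ENNReal.tsum_eq_iSup_sum]
    refine iSup_le fun F => ?_
    rw [← ENNReal.ofReal_sum_of_nonneg fun x _ => hs0 x, ENNReal.ofReal_le_iff_le_toReal hv.ne]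
    refine le_of_forall_pos_le_add fun κ' hκ' => ?_
    set κ := κ' / (F.card + 1) with hκdef
    have hκ : 0 < κ := by positivity
    obtain ⟨U, hU, hUd⟩ := F.finite_toSet.t2_separation
    have hγ : ∀ x : X, ∃ γ : MCurve X, γ.IsSimple ∧ γ.image ⊆ U x ∧
        sInf (T x) - κ ≤ |v (γ.toFun γ.len) - v (γ.toFun 0)| := by
      intro x
      obtain ⟨ε, hε, hball⟩ := Metric.isOpen_iff.1 (hU x).2 x (hU x).1
      obtain ⟨δ, hδ, harc⟩ := loc_arc h1 x hε
      obtain ⟨y, hy1, hy2⟩ := ((hfreq x κ hκ).and_eventually (Metric.ball_mem_nhds x hδ)).exists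
      obtain ⟨γ, hγ, hi, h0, hl⟩ := harc y hy2
      exact ⟨γ, hγ, hi.trans hball, by rw [h0, hl]; exact hy1⟩
    choose γ hγs hγi hγv using hγ
    have hp := le_pVar v (fun x : F => γ x) (fun x => hγs x) (by
      intro x y hxy
      exact (hUd x.2 y.2 (fun h => hxy (Subtype.ext h))).mono (hγi x) (hγi y))
    rw [← ENNReal.ofReal_sum_of_nonneg fun x _ => abs_nonneg _, ENNReal.ofReal_le_iff_le_toReal hv.ne,
      Finset.sum_coe_sort F (fun x => |v ((γ x).toFun (γ x).len) - v ((γ x).toFun 0)|)] at hp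
    have hsum : ∑ x ∈ F, (sInf (T x) - κ) ≤ ∑ x ∈ F, |v ((γ x).toFun (γ x).len) - v ((γ x).toFun 0)| :=
      Finset.sum_le_sum fun x _ => hγv x
    rw [Finset.sum_sub_distrib, Finset.sum_const, nsmul_eq_mul] at hsum
    have : F.card * κ ≤ κ' := by
      rw [hκdef, mul_div_assoc', div_le_iff₀ (by positivity)]
      nlinarith
    linarith

lemma osc_aemeas (v : X → ℝ) {s : X → ℝ} (hs0 : ∀ x, 0 ≤ s x) (hs : ∀ x, OscLe v x (s x))
    (hsum : ∑' x, ENNReal.ofReal (s x) ≠ ⊤) : AEMeasurable v (μH[1] : Measure X) := by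
  have hc := Summable.countable_support_ennreal hsum
  set J := Function.support fun x => ENNReal.ofReal (s x)
  have hcont : ContinuousOn v Jᶜ := by
    intro x hx
    apply ContinuousAt.continuousWithinAt
    apply OscLe.continuousAt
    have : s x = 0 := by
      have h : ENNReal.ofReal (s x) = 0 := by simpa [J] using hx
      exact le_antisymm (ENNReal.ofReal_eq_zero.1 h) (hs0 x)
    exact this ▸ hs x
  have h := hcont.aemeasurable (μ := (μH[1] : Measure X)) hc.measurableSet.compl
  have := Measure.noAtoms_hausdorff X (d := 1) one_pos
  rwa [Measure.restrict_eq_self_of_ae_mem] at h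
  exact compl_mem_ae_iff.2 (hc.measure_zero _)

lemma approx [Infinite X] {C₀ : ℝ} (hC₀ : 0 < C₀)
    (hdens : ∀ x : X, Filter.liminf
      (fun r : ℝ => μH[1] (Metric.ball x r) / ENNReal.ofReal r) (𝓝[>] 0)
      < ENNReal.ofReal C₀)
    (v : X → ℝ) (hv : pVar v < ⊤) {s : X → ℝ} (hs0 : ∀ x, 0 ≤ s x) (hs : ∀ x, OscLe v x (s x))
    (hsum : ∑' x, ENNReal.ofReal (s x) ≤ pVar v) {ε : ℝ} (hε : 0 < ε) :
    ∃ w : X → ℝ, Continuous w ∧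
      ∫⁻ x, ENNReal.ofReal |w x - v x| ∂(μH[1]) ≤ (pVar v + ENNReal.ofReal ε) * ENNReal.ofReal ε ∧
      pVar w ≤ pVar v + (pVar v + ENNReal.ofReal ε) * ENNReal.ofReal C₀ := by
  -- enumeration
  obtain ⟨e, he, hes⟩ : ∃ e : ℕ → X, Function.Injective e ∧ ∀ x, x ∉ range e → s x = 0 := by
    have hc := Summable.countable_support_ennreal (hsum.trans_lt hv).ne
    set J := Function.support fun x => ENNReal.ofReal (s x) with hJ
    let J' : Set X := J ∪ range (Infinite.natEmbedding X)
    have h1 : Countable J' := (hc.union (countable_range _)).to_subtype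
    have h2 : Infinite J' := Set.infinite_coe_iff.2
      ((Set.infinite_range_of_injective (Infinite.natEmbedding X).injective).mono subset_union_right)
    obtain ⟨hden⟩ := nonempty_denumerable J'
    refine ⟨fun n => ((Denumerable.eqv J').symm n : X),
      Subtype.val_injective.comp (Denumerable.eqv J').symm.injective, fun x hx => ?_⟩
    have hxJ : x ∉ J := fun h => hx ⟨Denumerable.eqv J' ⟨x, Or.inl h⟩, by simp⟩
    have h : ENNReal.ofReal (s x) = 0 := by simpa [J] using hxJ
    exact le_antisymm (ENNReal.ofReal_eq_zero.1 h) (hs0 x)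
  let εk : ℕ → ℝ := fun k => ε / 2 / 2 ^ k
  have hεk : ∀ k, 0 < εk k := fun k => by positivity
  have hεsum : HasSum εk ε := hasSum_geometric_two' ε
  have hstep : ∀ (k : ℕ) (f : {f : X → ℝ // ∀ z, OscLe f z (s z)}), ∃ f' : {f : X → ℝ // ∀ z, OscLe f z (s z)},
      OscLe f'.1 (e k) 0 ∧ (∀ z, OscLe f.1 z 0 → OscLe f'.1 z 0) ∧
      (∀ y, |f'.1 y - f.1 y| ≤ s (e k) + εk k) ∧
      (∃ U : Set X, (∀ y ∉ U, f'.1 y = f.1 y) ∧ μH[1] U ≤ ENNReal.ofReal (εk k)) ∧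
      pVar f'.1 ≤ pVar f.1 + ENNReal.ofReal ((s (e k) + εk k) * C₀) := by
    intro k f
    obtain ⟨f', h1, h2, h3, h4, h5⟩ := step hC₀ (hdens (e k)) f.1 (hs0 _) (f.2 (e k)) (hεk k)
    exact ⟨⟨f', fun z => h2 z _ (hs0 z) (f.2 z)⟩, h1, fun z => h2 z 0 le_rfl, h3, h4, h5⟩
  choose nxt hn1 hn2 hn3 hn4 hn5 using hstep
  let V : ℕ → {f : X → ℝ // ∀ z, OscLe f z (s z)} := fun n => Nat.rec ⟨v, hs⟩ (fun k f => nxt k f) n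
  have hV0 : (V 0).1 = v := rfl
  have hVs : ∀ k, V (k+1) = nxt k (V k) := fun k => rfl
  let a : ℕ → ℝ := fun k => s (e k) + εk k
  have ha0 : ∀ k, 0 ≤ a k := fun k => add_nonneg (hs0 _) (hεk k).le
  have hse : ∑' k, ENNReal.ofReal (s (e k)) ≤ pVar v :=
    (ENNReal.tsum_comp_le_tsum_of_injective he _).trans hsum
  have hasum' : ∑' k, ENNReal.ofReal (a k) ≤ pVar v + ENNReal.ofReal ε := by
    have : ∀ k, ENNReal.ofReal (a k) = ENNReal.ofReal (s (e k)) + ENNReal.ofReal (εk k) :=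
      fun k => ENNReal.ofReal_add (hs0 _) (hεk k).le
    simp_rw [this]
    rw [ENNReal.tsum_add, ← ENNReal.ofReal_tsum_of_nonneg (fun k => (hεk k).le) hεsum.summable, hεsum.tsum_eq]
    gcongr
  have hBtop : pVar v + ENNReal.ofReal ε < ⊤ := ENNReal.add_lt_top.2 ⟨hv, ENNReal.ofReal_lt_top⟩
  have hasm : Summable a := by
    have := ENNReal.summable_toReal (hasum'.trans_lt hBtop).ne
    simpa [ENNReal.toReal_ofReal, ha0] using this
  have hatot : ENNReal.ofReal (∑' k, a k) ≤ pVar v + ENNReal.ofReal ε := by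
    rw [ENNReal.ofReal_tsum_of_nonneg ha0 hasm]; exact hasum'
  have hd : ∀ y n, dist ((V n).1 y) ((V (n+1)).1 y) ≤ a n := by
    intro y n
    rw [dist_comm, Real.dist_eq, hVs]
    exact hn3 n (V n) y
  have hlim : ∀ y, ∃ l, Tendsto (fun n => (V n).1 y) atTop (𝓝 l) := fun y =>
    cauchySeq_tendsto_of_complete (cauchySeq_of_dist_le_of_summable a (hd y) hasm)
  choose w hw using hlim
  have htail : ∀ y n, dist ((V n).1 y) (w y) ≤ ∑' m, a (n + m) := fun y n =>
    dist_le_tsum_of_dist_le_of_tendsto a (hd y) hasm (hw y) n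
  have hkill : ∀ k n, k < n → OscLe (V n).1 (e k) 0 := by
    intro k n hkn
    induction n, hkn using Nat.le_induction with
    | base => rw [hVs]; exact hn1 k _
    | succ n _ ih => rw [hVs]; exact hn2 n _ _ ih
  choose U hU1 hU2 using fun k => hn4 k (V k)
  refine ⟨w, ?_, ?_, ?_⟩
  · rw [continuous_iff_continuousAt]
    intro x
    obtain ⟨N, hN⟩ : ∃ N, ∀ n ≥ N, ContinuousAt (V n).1 x := by
      by_cases hx : x ∈ range e
      · obtain ⟨k, rfl⟩ := hx
        exact ⟨k+1, fun n hn => (hkill k n hn).continuousAt⟩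
      · refine ⟨0, fun n _ => OscLe.continuousAt ?_⟩
        have := (V n).2 x
        rwa [hes x hx] at this
    apply continuousAt_of_locally_uniform_approx_of_continuousAt
    intro u hu
    obtain ⟨κ, hκ, hκu⟩ := Metric.mem_uniformity_dist.1 hu
    have ht : Tendsto (fun n => ∑' m, a (n + m)) atTop (𝓝 0) := by
      simpa [add_comm] using tendsto_sum_nat_add a
    obtain ⟨n, hn1, hn2⟩ := ((ht.eventually (gt_mem_nhds hκ)).and (eventually_ge_atTop N)).exists
    refine ⟨univ, univ_mem, (V n).1, hN n hn2, fun y _ => hκu ?_⟩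
    rw [dist_comm]
    exact (htail y n).trans_lt hn1
  · set W := ⋃ k, U k
    have hWm : μH[1] W ≤ ENNReal.ofReal ε := by
      refine (measure_iUnion_le U).trans ((ENNReal.tsum_le_tsum hU2).trans ?_)
      rw [← ENNReal.ofReal_tsum_of_nonneg (fun k => (hεk k).le) hεsum.summable, hεsum.tsum_eq]
    have hout : ∀ y ∉ W, w y = v y := by
      intro y hy
      have : ∀ n, (V n).1 y = v y := by
        intro n
        induction n with
        | zero => rfl
        | succ n ih =>
          rw [hVs, hU1 n y (fun h => hy (mem_iUnion.2 ⟨n, h⟩)), ih]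
      exact tendsto_nhds_unique (hw y) (tendsto_const_nhds.congr fun n => (this n).symm)
    calc ∫⁻ x, ENNReal.ofReal |w x - v x| ∂(μH[1])
        ≤ ∫⁻ x, (toMeasurable (μH[1]) W).indicator (fun _ => pVar v + ENNReal.ofReal ε) x ∂(μH[1]) := by
          refine lintegral_mono fun x => ?_
          by_cases hx : x ∈ W
          · rw [indicator_of_mem (subset_toMeasurable _ _ hx)]
            refine le_trans (ENNReal.ofReal_le_ofReal ?_) hatot
            have := htail x 0
            rw [dist_comm, Real.dist_eq, hV0] at this
            simpa using this
          · simp [hout x hx]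
      _ = (pVar v + ENNReal.ofReal ε) * μH[1] W := by
          rw [lintegral_indicator_const (measurableSet_toMeasurable _ _), measure_toMeasurable]
      _ ≤ _ := mul_le_mul_right hWm _
  · have hpV : ∀ n, pVar (V n).1 ≤ pVar v + ENNReal.ofReal ((∑ k ∈ Finset.range n, a k) * C₀) := by
      intro n
      induction n with
      | zero => simp [hV0]
      | succ n ih =>
        rw [hVs, Finset.sum_range_succ, add_mul, ENNReal.ofReal_add
          (mul_nonneg (Finset.sum_nonneg fun k _ => ha0 k) hC₀.le) (mul_nonneg (ha0 n) hC₀.le), ← add_assoc]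
        exact (hn5 n (V n)).trans (add_le_add ih le_rfl)
    have hpV' : ∀ n, pVar (V n).1 ≤ pVar v + (pVar v + ENNReal.ofReal ε) * ENNReal.ofReal C₀ := by
      intro n
      refine (hpV n).trans ?_
      rw [ENNReal.ofReal_mul (Finset.sum_nonneg fun k _ => ha0 k)]
      gcongr
      exact (ENNReal.ofReal_le_ofReal (hasm.sum_le_tsum _ fun k _ => ha0 k)).trans hatot
    refine pVar_le _ _ fun n γ h1 h2 => ?_
    have ht : Tendsto (fun m => ∑ i, ENNReal.ofReal |(V m).1 ((γ i).toFun (γ i).len) - (V m).1 ((γ i).toFun 0)|)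
        atTop (𝓝 (∑ i, ENNReal.ofReal |w ((γ i).toFun (γ i).len) - w ((γ i).toFun 0)|)) := by
      refine tendsto_finset_sum _ fun i _ => ?_
      exact (ENNReal.continuous_ofReal.tendsto _).comp ((hw _).sub (hw _)).abs
    exact le_of_tendsto' ht fun m => (le_pVar _ γ h1 h2).trans (hpV' m)

end Approx

theorem stmt13 {X : Type*} [MetricSpace X] [CompleteSpace X] [ConnectedSpace X]
    [MeasurableSpace X] [BorelSpace X]
    (h0 : 0 < μH[1] (Set.univ : Set X)) (h1 : μH[1] (Set.univ : Set X) < ⊤)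
    (C₀ : ℝ) (hC₀ : 0 < C₀)
    (hdens : ∀ x : X, Filter.liminf
      (fun r : ℝ => μH[1] (Metric.ball x r) / ENNReal.ofReal r) (𝓝[>] 0)
      < ENNReal.ofReal C₀)
    (u : X → ℝ) (hu : VarH (μH[1]) u < ⊤) :
    AEMeasurable u (μH[1] : Measure X) ∧
    ∃ ui : ℕ → X → ℝ, (∀ i, CurveContinuous (ui i)) ∧
      Filter.Tendsto (fun i => ∫⁻ x, ENNReal.ofReal |ui i x - u x| ∂(μH[1]))
        Filter.atTop (nhds 0) ∧
      Filter.atTop.limsup (fun i => pVar (ui i))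
        ≤ ENNReal.ofReal (3 + 4 * C₀) * VarH (μH[1]) u := by
  haveI : CompactSpace X := compact_of_fin h1
  haveI : NullSingletonClass (μH[1] : Measure X) := Measure.nullSingletonClass_hausdorff X one_pos
  haveI : Infinite X := by
    by_contra hfin
    rw [not_infinite_iff_finite] at hfin
    exact h0.ne' (Set.Finite.measure_zero Set.finite_univ (μH[1] : Measure X))
  have hδpos : ∀ n : ℕ, (0 : ℝ) < 1 / ((n : ℝ) + 1) := fun n => by positivity
  have key : ∀ n : ℕ, ∃ v w : X → ℝ, v =ᵐ[μH[1]] u ∧ AEMeasurable v (μH[1] : Measure X) ∧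
      Continuous w ∧
      ∫⁻ x, ENNReal.ofReal |w x - u x| ∂μH[1] ≤
        (VarH μH[1] u + ENNReal.ofReal (1 / ((n : ℝ) + 1)) +
          ENNReal.ofReal (1 / ((n : ℝ) + 1))) * ENNReal.ofReal (1 / ((n : ℝ) + 1)) ∧
      pVar w ≤ (VarH μH[1] u + ENNReal.ofReal (1 / ((n : ℝ) + 1))) +
        (VarH μH[1] u + ENNReal.ofReal (1 / ((n : ℝ) + 1)) +
          ENNReal.ofReal (1 / ((n : ℝ) + 1))) * ENNReal.ofReal C₀ := by
    intro n
    have hlt : VarH μH[1] u < VarH μH[1] u + ENNReal.ofReal (1 / ((n : ℝ) + 1)) :=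
      ENNReal.lt_add_right hu.ne (ENNReal.ofReal_pos.2 (hδpos n)).ne'
    have hlt2 := hlt
    conv_lhs at hlt2 => rw [VarH]
    obtain ⟨v, hlt3⟩ := iInf_lt_iff.1 hlt2
    obtain ⟨hvu, hlt4⟩ := iInf_lt_iff.1 hlt3
    have hv : pVar v < ⊤ := lt_top_of_lt hlt4
    obtain ⟨s, hs0, hs, hsum⟩ := exists_osc h1 v hv
    have hm := osc_aemeas v hs0 hs (lt_of_le_of_lt hsum hv).ne
    obtain ⟨w, hw, hwi, hwp⟩ := approx hC₀ hdens v hv hs0 hs hsum (hδpos n)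
    refine ⟨v, w, hvu, hm, hw, ?_, ?_⟩
    · have he : ∫⁻ x, ENNReal.ofReal |w x - u x| ∂μH[1] =
          ∫⁻ x, ENNReal.ofReal |w x - v x| ∂μH[1] := by
        apply lintegral_congr_ae
        filter_upwards [hvu] with x hx
        rw [hx]
      rw [he]
      refine hwi.trans ?_
      gcongr
    · refine hwp.trans ?_
      gcongr
  choose v w hvu hm hw hwi hwp using key
  have hδ : Tendsto (fun n : ℕ => ENNReal.ofReal (1 / ((n : ℝ) + 1))) atTop (𝓝 0) := by
    have := ENNReal.tendsto_ofReal (tendsto_one_div_add_atTop_nhds_zero_nat (𝕜 := ℝ))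
    simpa using this
  have hA : Tendsto (fun n : ℕ => VarH μH[1] u + ENNReal.ofReal (1 / ((n : ℝ) + 1))) atTop
      (𝓝 (VarH μH[1] u)) := by
    simpa using (tendsto_const_nhds (x := VarH μH[1] u)).add hδ
  have hB : Tendsto (fun n : ℕ => VarH μH[1] u + ENNReal.ofReal (1 / ((n : ℝ) + 1)) +
      ENNReal.ofReal (1 / ((n : ℝ) + 1))) atTop (𝓝 (VarH μH[1] u)) := by
    simpa using hA.add hδ
  refine ⟨(hm 0).congr (hvu 0), w, fun i γ => (hw i).comp_continuousOn γ.contOn, ?_, ?_⟩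
  · refine tendsto_of_tendsto_of_tendsto_of_le_of_le tendsto_const_nhds ?_
      (fun _ => zero_le) hwi
    have := ENNReal.Tendsto.mul hB (Or.inr ENNReal.zero_ne_top) hδ (Or.inr hu.ne)
    simpa using this
  · have hC : Tendsto (fun n : ℕ => (VarH μH[1] u + ENNReal.ofReal (1 / ((n : ℝ) + 1))) +
        (VarH μH[1] u + ENNReal.ofReal (1 / ((n : ℝ) + 1)) +
          ENNReal.ofReal (1 / ((n : ℝ) + 1))) * ENNReal.ofReal C₀) atTop
        (𝓝 (VarH μH[1] u + VarH μH[1] u * ENNReal.ofReal C₀)) :=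
      hA.add (ENNReal.Tendsto.mul_const hB (Or.inr ENNReal.ofReal_ne_top))
    calc Filter.atTop.limsup (fun i => pVar (w i)) ≤ _ :=
          limsup_le_limsup (Eventually.of_forall hwp)
      _ = VarH μH[1] u + VarH μH[1] u * ENNReal.ofReal C₀ := hC.limsup_eq
      _ = ENNReal.ofReal (1 + C₀) * VarH μH[1] u := by
          rw [ENNReal.ofReal_add zero_le_one hC₀.le, ENNReal.ofReal_one]; ring
      _ ≤ _ := by
          gcongr
          · norm_num
          · linarith
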